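/- Let φ be a minimal homeomorphism of a Cantor set X and σ an involutive homeomorphism of X with σ∘φ∘σ = φ⁻¹, giving an action α of ℤ⋊ℤ₂ via α_{(n,i)} = φⁿ∘σ^i. Suppose α is free. Then there exist clopen sets K, L ⊆ X with X = K ⊔ σ(K) and X = L ⊔ φ(σ(L)), and for any such K, L the kernel of the transfer map tr : C(X,ℤ)/N → C(X,ℤ)/B, [f] ↦ [f + f∘σ], equals {[0], [1_K − 1_L]}, where [1_K − 1_L] ≠ 0 and 2[1_K − 1_L] = 0; that is, ker tr ≅ ℤ/2ℤ generated by [1_K] − [1_L]. -/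

import Mathlib

variable {X : Type*} [TopologicalSpace X]

/-- The subgroup `B = {h - h ∘ ψ : h ∈ C(Z, ℤ)}` of `C(Z, ℤ)`. -/
def coboundariesSubgroup {Z : Type*} [TopologicalSpace Z] (ψ : C(Z, Z)) :
    AddSubgroup C(Z, ℤ) :=
  (AddMonoidHom.mk' (fun h : C(Z, ℤ) => h - h.comp ψ)
    (fun f g => by ext x; simp; ring)).range

/-- The subgroup `N` of `C(X, ℤ)` generated by
`{f - f ∘ φ : f ∈ C(X, ℤ)} ∪ {f - f ∘ σ : f ∈ C(X, ℤ)}`. -/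
def dihedralCoboundaries (φ σ : X ≃ₜ X) : AddSubgroup C(X, ℤ) :=
  AddSubgroup.closure
    ({f | ∃ g : C(X, ℤ), f = g - g.comp (φ : C(X, X))} ∪
      {f | ∃ g : C(X, ℤ), f = g - g.comp (σ : C(X, X))})

/-- The indicator function of a clopen set, as a continuous integer-valued function. -/
noncomputable def indicatorC (K : Set X) (hK : IsClopen K) : C(X, ℤ) := by
  classical
  exact ⟨K.piecewise (fun _ => 1) (fun _ => 0),
    Continuous.piecewise (by simp [hK.frontier_eq]) continuous_const continuous_const⟩

lemma exists_isClopen_transversal_of_involutive {X : Type*} [TopologicalSpace X] [CompactSpace X]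
    [T2Space X] [TotallyDisconnectedSpace X] (s : C(X, X)) (hs : Function.Involutive s)
    (hfix : ∀ x, s x ≠ x) : ∃ K : Set X, IsClopen K ∧ ∀ x, x ∈ K ↔ s x ∉ K := by
  suffices H : ∃ K : Set X, IsClopen K ∧ (∀ x ∈ K, s x ∉ K) ∧
      ∀ x ∈ (Set.univ : Set X), x ∈ K ∨ s x ∈ K by
    obtain ⟨K, hK, h₁, h₂⟩ := H
    exact ⟨K, hK, fun x => ⟨h₁ x, fun h => (h₂ x trivial).resolve_right h⟩⟩
  refine isCompact_univ.induction_on (p := fun t => ∃ K : Set X, IsClopen K ∧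
    (∀ x ∈ K, s x ∉ K) ∧ ∀ x ∈ t, x ∈ K ∨ s x ∈ K) ?_ ?_ ?_ ?_
  · exact ⟨∅, isClopen_empty, by simp, by simp⟩
  · rintro t u htu ⟨K, hK, h₁, h₂⟩
    exact ⟨K, hK, h₁, fun x hx => h₂ x (htu hx)⟩
  · rintro t u ⟨K, hK, h₁, h₂⟩ ⟨M, hM, h₃, h₄⟩
    refine ⟨K ∪ (M \ (K ∪ s ⁻¹' K)),
      hK.union (hM.diff (hK.union (hK.preimage s.continuous))), ?_, ?_⟩
    · intro x hx
      have := h₁ x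
      have := h₃ x
      have := hs x
      simp only [Set.mem_union, Set.mem_sdiff, Set.mem_preimage] at *
      grind
    · intro x hx
      have := h₂ x
      have := h₄ x
      have := hs x
      simp only [Set.mem_union, Set.mem_sdiff, Set.mem_preimage] at *
      grind
  · intro x _
    obtain ⟨U, V, hU, hV, hxU, hxV, hUV⟩ := t2_separation (hfix x).symm
    obtain ⟨W, hW, hxW, hWU⟩ := compact_exists_isClopen_in_isOpen
      (hU.inter (hV.preimage s.continuous)) (show x ∈ U ∩ s ⁻¹' V from ⟨hxU, hxV⟩)
    refine ⟨W, mem_nhdsWithin_of_mem_nhds (hW.isOpen.mem_nhds hxW), W, hW, ?_, fun y hy => .inl hy⟩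
    exact fun y hy hsy => Set.disjoint_left.mp hUV (hWU hsy).1 (hWU hy).2

lemma disjoint_image_and_union_image_eq_univ_iff {X : Type*} {s : X → X}
    (hs : Function.Involutive s) (K : Set X) :
    (Disjoint K (s '' K) ∧ K ∪ s '' K = Set.univ) ↔ ∀ x, x ∈ K ↔ s x ∉ K := by
  rw [hs.image_eq_preimage_symm, Set.disjoint_left, Set.eq_univ_iff_forall, ← forall_and]
  refine forall_congr' fun x => ?_
  simp only [Set.mem_preimage, Set.mem_union]
  tauto

lemma indicatorC_add_comp {X : Type*} [TopologicalSpace X] (s : C(X, X)) (K : Set X)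
    (hK : IsClopen K) (h : ∀ x, x ∈ K ↔ s x ∉ K) :
    indicatorC K hK + (indicatorC K hK).comp s = 1 := by
  ext x
  have := h x
  by_cases hsx : s x ∈ K
  · simp [indicatorC, hsx, mt this.1 (not_not.2 hsx)]
  · simp [indicatorC, hsx, this.2 hsx]

/-- A function which is anti-invariant under an involution with a clopen transversal is a
coboundary for this involution. -/
lemma exists_eq_sub_comp_of_add_comp_eq_zero {X : Type*} [TopologicalSpace X] (s : C(X, X))
    (K : Set X) (hK : IsClopen K) (h : ∀ x, x ∈ K ↔ s x ∉ K)
    (u : C(X, ℤ)) (hu : u + u.comp s = 0) : ∃ g : C(X, ℤ), u = g - g.comp s := by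
  refine ⟨u * indicatorC K hK, ?_⟩
  ext x
  have h₁ := DFunLike.congr_fun (indicatorC_add_comp s K hK h) x
  have h₂ := DFunLike.congr_fun hu x
  simp only [ContinuousMap.add_apply, ContinuousMap.comp_apply, ContinuousMap.one_apply,
    ContinuousMap.zero_apply, ContinuousMap.sub_apply, ContinuousMap.mul_apply] at *
  linear_combination (-u x) * h₁ + indicatorC K hK (s x) * h₂

lemma exists_const_of_comp_eq {X : Type*} [TopologicalSpace X] [Nonempty X] (φ : X ≃ₜ X)
    (hφmin : ∀ x : X, Dense (Set.range fun n : ℤ => (φ.toEquiv ^ n) x))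
    (u : C(X, ℤ)) (hu : ∀ x, u (φ x) = u x) : ∃ c : ℤ, ∀ x, u x = c := by
  obtain ⟨x₀⟩ := ‹Nonempty X›
  refine ⟨u x₀, fun x => ?_⟩
  have key : ∀ n : ℤ, u ((φ.toEquiv ^ n) x₀) = u x₀ := by
    intro n
    induction n with
    | zero => simp
    | succ n ih =>
      rw [← ih, add_comm, zpow_add, zpow_one]
      exact hu _
    | pred n ih =>
      rw [← ih, ← hu, ← Homeomorph.coe_toEquiv φ, ← Equiv.Perm.mul_apply, ← zpow_one_add]
      congr 3
      ring
  have := Continuous.ext_on (hφmin x₀) u.continuous (continuous_const (y := u x₀))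
    (by rintro _ ⟨n, rfl⟩; exact key n)
  exact congrFun this x

/-- The subgroup of dihedral coboundaries is generated by the coboundaries of the two
involutions `σ` and `φ ∘ σ`. -/
lemma mem_dihedralCoboundaries_iff {X : Type*} [TopologicalSpace X] (φ σ : X ≃ₜ X)
    (hσ : ∀ x, σ (σ x) = x) (f : C(X, ℤ)) :
    f ∈ dihedralCoboundaries φ σ ↔ ∃ a b : C(X, ℤ), f = (a - a.comp (σ : C(X, X))) +
      (b - b.comp ((φ : C(X, X)).comp (σ : C(X, X)))) := by
  constructor
  · intro hf
    induction hf using AddSubgroup.closure_induction with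
    | mem f hf =>
      rcases hf with ⟨g, rfl⟩ | ⟨g, rfl⟩
      · refine ⟨g.comp ((φ : C(X, X)).comp (σ : C(X, X))), g, ?_⟩
        ext x
        simp [hσ]
      · exact ⟨g, 0, by ext x; simp⟩
    | zero => exact ⟨0, 0, by ext x; simp⟩
    | add f g _ _ hf hg =>
      obtain ⟨a, b, rfl⟩ := hf
      obtain ⟨c, d, rfl⟩ := hg
      refine ⟨a + c, b + d, ?_⟩
      ext x
      simp
      ring
    | neg f _ hf =>
      obtain ⟨a, b, rfl⟩ := hf
      refine ⟨-a, -b, ?_⟩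
      ext x
      simp
      ring
  · rintro ⟨a, b, rfl⟩
    have h : (a - a.comp (σ : C(X, X))) + (b - b.comp ((φ : C(X, X)).comp (σ : C(X, X)))) =
        (b - b.comp (φ : C(X, X))) +
          ((a + b.comp (φ : C(X, X))) - (a + b.comp (φ : C(X, X))).comp (σ : C(X, X))) := by
      ext x
      simp
      ring
    rw [h]
    exact add_mem (AddSubgroup.subset_closure (.inl ⟨_, rfl⟩))
      (AddSubgroup.subset_closure (.inr ⟨_, rfl⟩))

/-- Let `φ` be a minimal homeomorphism of a Cantor set `X` and `σ` an involutive
homeomorphism with `σφσ = φ⁻¹`, such that the associated `ℤ ⋊ ℤ₂`-action is free.  Then there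
are clopen sets `K`, `L` with `X = K ⊔ σ(K) = L ⊔ φσ(L)`, and for any such `K`, `L` the
kernel of the transfer map `tr : C(X, ℤ)/N → C(X, ℤ)/B`, `[f] ↦ [f + f ∘ σ]`, is the
two-element subgroup `{0, [1_K - 1_L]} ≅ ℤ/2` generated by `[1_K] - [1_L]`. -/
theorem transfer_kernel_of_free {X : Type*} [TopologicalSpace X] [CompactSpace X]
    [TopologicalSpace.MetrizableSpace X] [TotallyDisconnectedSpace X] [PerfectSpace X]
    [Nonempty X] (φ σ : X ≃ₜ X)
    (hφmin : ∀ x : X, Dense (Set.range fun n : ℤ => (φ.toEquiv ^ n) x))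
    (hσ : ∀ x, σ (σ x) = x) (hrel : ∀ x, σ (φ (σ x)) = φ.symm x)
    (hfree : ∀ (n : ℤ) (i : Bool) (x : X),
      (φ.toEquiv ^ n) (cond i (σ x) x) = x → n = 0 ∧ i = false) :
    (∃ K L : Set X, IsClopen K ∧ IsClopen L ∧
      Disjoint K (σ '' K) ∧ K ∪ σ '' K = Set.univ ∧
      Disjoint L ((fun x => φ (σ x)) '' L) ∧ L ∪ (fun x => φ (σ x)) '' L = Set.univ) ∧
    (∀ (K L : Set X) (hK : IsClopen K) (hL : IsClopen L),
      Disjoint K (σ '' K) → K ∪ σ '' K = Set.univ →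
      Disjoint L ((fun x => φ (σ x)) '' L) → L ∪ (fun x => φ (σ x)) '' L = Set.univ →
      (indicatorC K hK - indicatorC L hL) + (indicatorC K hK - indicatorC L hL).comp
          (σ : C(X, X)) ∈ coboundariesSubgroup (φ : C(X, X)) ∧
      indicatorC K hK - indicatorC L hL ∉ dihedralCoboundaries φ σ ∧
      (indicatorC K hK - indicatorC L hL) + (indicatorC K hK - indicatorC L hL) ∈
        dihedralCoboundaries φ σ ∧
      (∀ f : C(X, ℤ), f + f.comp (σ : C(X, X)) ∈ coboundariesSubgroup (φ : C(X, X)) →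
        f ∈ dihedralCoboundaries φ σ ∨
          f - (indicatorC K hK - indicatorC L hL) ∈ dihedralCoboundaries φ σ)) := by
  have hφσφ : ∀ x, φ (σ (φ x)) = σ x := fun x => by
    have h := hrel (σ x)
    rw [hσ] at h
    rw [h, φ.apply_symm_apply]
  set s : C(X, X) := (σ : C(X, X))
  set t : C(X, X) := (φ : C(X, X)).comp s
  have hs : Function.Involutive s := hσ
  have ht : Function.Involutive t := fun x => (hφσφ (σ x)).trans (hσ x)
  have hts : ∀ x, t (s x) = φ x := fun x => congrArg φ (hσ x)
  have htφ : ∀ x, t (φ x) = s x := hφσφ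
  have hN : ∀ f : C(X, ℤ), f ∈ dihedralCoboundaries φ σ ↔
      ∃ a b : C(X, ℤ), f = (a - a.comp s) + (b - b.comp t) := mem_dihedralCoboundaries_iff φ σ hσ
  refine ⟨?_, ?_⟩
  · obtain ⟨K, hK, hKs⟩ := exists_isClopen_transversal_of_involutive s hs fun x hx => by
      simpa using (hfree 0 true x hx).2
    obtain ⟨L, hL, hLt⟩ := exists_isClopen_transversal_of_involutive t ht fun x hx => by
      simpa using (hfree 1 true x hx).2
    obtain ⟨h₁, h₂⟩ := (disjoint_image_and_union_image_eq_univ_iff hs K).2 hKs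
    obtain ⟨h₃, h₄⟩ := (disjoint_image_and_union_image_eq_univ_iff ht L).2 hLt
    exact ⟨K, L, hK, hL, h₁, h₂, h₃, h₄⟩
  intro K L hK hL h₁ h₂ h₃ h₄
  have hKs := (disjoint_image_and_union_image_eq_univ_iff hs K).1 ⟨h₁, h₂⟩
  have hLt := (disjoint_image_and_union_image_eq_univ_iff ht L).1 ⟨h₃, h₄⟩
  have hk : ∀ x, indicatorC K hK x + indicatorC K hK (s x) = 1 :=
    DFunLike.congr_fun (indicatorC_add_comp s K hK hKs)
  have hl : ∀ x, indicatorC L hL x + indicatorC L hL (t x) = 1 :=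
    DFunLike.congr_fun (indicatorC_add_comp t L hL hLt)
  have hKN := exists_eq_sub_comp_of_add_comp_eq_zero s K hK hKs
  have hLN := exists_eq_sub_comp_of_add_comp_eq_zero t L hL hLt
  set k := indicatorC K hK
  set l := indicatorC L hL
  have htwo : (k - l) + (k - l) ∈ dihedralCoboundaries φ σ := by
    refine (hN _).2 ⟨k, -l, ?_⟩
    ext x
    have := hk x
    have := hl x
    simp only [ContinuousMap.add_apply, ContinuousMap.comp_apply, ContinuousMap.neg_apply,
      ContinuousMap.sub_apply]
    linarith
  refine ⟨⟨l.comp t, ?_⟩, ?_, htwo, ?_⟩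
  · ext x
    have := hk x
    have := hl x
    have h : l (t (φ x)) = l (s x) := by rw [htφ]
    simp only [AddMonoidHom.mk'_apply, ContinuousMap.add_apply, ContinuousMap.comp_apply,
      ContinuousMap.sub_apply, ContinuousMap.coe_coe] at *
    linarith
  · intro hmem
    obtain ⟨a, b, hab⟩ := (hN _).1 hmem
    have hab' : ∀ x, k x - l x = (a x - a (s x)) + (b x - b (t x)) := DFunLike.congr_fun hab
    set u : C(X, ℤ) := k - (a - a.comp s) with hu
    have hus : ∀ x, u x + u (s x) = 1 := fun x => by
      have := hk x
      simp only [hu, ContinuousMap.sub_apply, ContinuousMap.comp_apply, hs x]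
      linarith
    have hut : ∀ x, u x + u (t x) = 1 := fun x => by
      have := hl x
      have h₁ := hab' x
      have h₂ := hab' (t x)
      rw [ht x] at h₂
      simp only [hu, ContinuousMap.sub_apply, ContinuousMap.comp_apply]
      linarith
    obtain ⟨c, hc⟩ := exists_const_of_comp_eq φ hφmin u fun x => by
      have h₁ := hut (s x)
      have h₂ := hus x
      rw [hts] at h₁
      linarith
    obtain ⟨x⟩ := ‹Nonempty X›
    have := hus x
    rw [hc, hc] at this
    omega
  · rintro f ⟨h, hh⟩
    have hf : ∀ x, h x - h (φ x) = f x + f (s x) := DFunLike.congr_fun hh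
    obtain ⟨c, hc⟩ := exists_const_of_comp_eq φ hφmin (h + h.comp t) fun x => by
      have h₁ := hf x
      have h₂ := hf (s x)
      have h₃ : φ (s x) = t x := rfl
      rw [hs x, h₃] at h₂
      simp only [ContinuousMap.add_apply, ContinuousMap.comp_apply, htφ]
      linarith
    replace hc : ∀ x, h x + h (t x) = c := hc
    have hfh : ∀ x, f x + f (s x) = h x + h (s x) - c := fun x => by
      have h₁ := hc (s x)
      have h₂ := hf x
      rw [hts] at h₁
      linarith
    obtain ⟨d, hd | hd⟩ := Int.even_or_odd' c
    · left
      obtain ⟨a, ha⟩ := hKN (f - h + ContinuousMap.const X d) (by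
        ext x
        have := hfh x
        simp only [ContinuousMap.add_apply, ContinuousMap.comp_apply, ContinuousMap.sub_apply,
          ContinuousMap.const_apply, ContinuousMap.zero_apply]
        linarith)
      obtain ⟨b, hb⟩ := hLN (h - ContinuousMap.const X d) (by
        ext x
        have := hc x
        simp only [ContinuousMap.add_apply, ContinuousMap.comp_apply, ContinuousMap.sub_apply,
          ContinuousMap.const_apply, ContinuousMap.zero_apply]
        linarith)
      refine (hN _).2 ⟨a, b, ?_⟩
      rw [← ha, ← hb]
      abel
    · right
      obtain ⟨a, ha⟩ := hKN (f - h + ContinuousMap.const X d + k) (by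
        ext x
        have := hfh x
        have := hk x
        simp only [ContinuousMap.add_apply, ContinuousMap.comp_apply, ContinuousMap.sub_apply,
          ContinuousMap.const_apply, ContinuousMap.zero_apply]
        linarith)
      obtain ⟨b, hb⟩ := hLN (h - ContinuousMap.const X d - l) (by
        ext x
        have := hc x
        have := hl x
        simp only [ContinuousMap.add_apply, ContinuousMap.comp_apply, ContinuousMap.sub_apply,
          ContinuousMap.const_apply, ContinuousMap.zero_apply]
        linarith)
      have hmem : f + (k - l) ∈ dihedralCoboundaries φ σ := by
        refine (hN _).2 ⟨a, b, ?_⟩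
        rw [← ha, ← hb]
        abel
      have := sub_mem hmem htwo
      rwa [add_sub_add_right_eq_sub] at this
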